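/- arXiv:1610.01800 — 11 statements merged into one kernel-verified Lean document; each statement's English description precedes it below -/
import Mathlib

section
/- Let L be a complete lattice equipped with a commutator multiplication [·,·], with associated residuation (·:·). Let α, β, γ, δ ∈ L satisfy α ≤ β, γ ≤ δ, and [α,β] ⟷ [γ,δ] (the intervals are projective). Then (1) (α : β) = (γ : δ), and (2) [β,β] ≤ α if and only if [δ,δ] ≤ γ. -/
/-- A commutator multiplication on a complete lattice `L`: a binary operation that is
commutative, below the meet, and distributes over arbitrary joins. -/
def IsCommutatorMult {L : Type*} [CompleteLattice L] (c : L → L → L) : Prop :=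
  (∀ x y : L, c x y = c y x) ∧
  (∀ x y : L, c x y ≤ x ⊓ y) ∧
  (∀ (S : Set L) (y : L), c (sSup S) y = ⨆ x ∈ S, c x y)

/-- The residuation `(x : y)` associated with a commutator multiplication. -/
def resid {L : Type*} [CompleteLattice L] (c : L → L → L) (x y : L) : L :=
  sSup {z : L | c z y ≤ x}

/-- `[α, β] ↗ [γ, δ]`, i.e. `δ = β ⊔ γ` and `α = β ⊓ γ`. -/
def TransUp {L : Type*} [Lattice L] (p q : L × L) : Prop :=
  q.2 = p.2 ⊔ q.1 ∧ p.1 = p.2 ⊓ q.1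

/-- Projectivity of intervals: the equivalence relation generated by `↗`. -/
def ProjIntv {L : Type*} [Lattice L] : L × L → L × L → Prop :=
  Relation.EqvGen TransUp

/-- `η⁺ = ⋀ { β | η < β }`. -/
def mplus {L : Type*} [CompleteLattice L] (η : L) : L := sInf {β : L | η < β}

/-- `ρ⁻ = ⋁ { α | α < ρ }`. -/
def jminus {L : Type*} [CompleteLattice L] (ρ : L) : L := sSup {α : L | α < ρ}

/-- `η` is meet irreducible if `η < η⁺`. -/
def MeetIrred {L : Type*} [CompleteLattice L] (η : L) : Prop := η < mplus η

/-- `ρ` is join irreducible if `ρ⁻ < ρ`. -/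
def JoinIrred {L : Type*} [CompleteLattice L] (ρ : L) : Prop := jminus ρ < ρ

/-- `Γ(α,β) = ⋁ { η ∈ M(L) | [η,η⁺] ⟷ [α,β] }`. -/
def GammaEl {L : Type*} [CompleteLattice L] (α β : L) : L :=
  sSup {η : L | MeetIrred η ∧ ProjIntv (η, mplus η) (α, β)}

/-- `Δ(α,β) = ⋁ { ρ ∈ J(L) | [ρ⁻,ρ] ⟷ [α,β] }`. -/
def DeltaEl {L : Type*} [CompleteLattice L] (α β : L) : L :=
  sSup {ρ : L | JoinIrred ρ ∧ ProjIntv (jminus ρ, ρ) (α, β)}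

/-- A lonesome meet irreducible element. -/
def LonesomeMeet {L : Type*} [CompleteLattice L] (η : L) : Prop :=
  MeetIrred η ∧ ∀ φ : L, MeetIrred φ → ProjIntv (φ, mplus φ) (η, mplus η) → φ = η

/-- A lonesome join irreducible element. -/
def LonesomeJoin {L : Type*} [CompleteLattice L] (ρ : L) : Prop :=
  JoinIrred ρ ∧ ∀ σ : L, JoinIrred σ → ProjIntv (jminus σ, σ) (jminus ρ, ρ) → σ = ρ

/-- The interval `[a,b]` projects into the interval `[c,d]`. -/
def ProjInto {L : Type*} [CompleteLattice L] (a b c d : L) : Prop :=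
  ∃ a₁ b₁ : L, c ≤ a₁ ∧ a₁ ≤ b₁ ∧ b₁ ≤ d ∧ ProjIntv (a, b) (a₁, b₁)

/-- A complete congruence on a complete lattice. -/
def IsCompleteCongruence {L : Type*} [CompleteLattice L] (Θ : L → L → Prop) : Prop :=
  Equivalence Θ ∧
  ∀ S : Set (L × L), (∀ p ∈ S, Θ p.1 p.2) →
    Θ (⨆ p ∈ S, p.1) (⨆ p ∈ S, p.2) ∧ Θ (⨅ p ∈ S, p.1) (⨅ p ∈ S, p.2)

/-- The largest commutator operation `⌊x,y⌋` on a complete lattice. -/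
def lcomm {L : Type*} [CompleteLattice L] (x y : L) : L :=
  sSup {z : L | ∃ c : L → L → L, IsCommutatorMult c ∧ z = c x y}

/-- The derived series `γ₁ = 1, γ_{n+1} = [γ_n, γ_n]` (indexed from 0). -/
def derivedSeq {L : Type*} [CompleteLattice L] (c : L → L → L) : ℕ → L
  | 0 => ⊤
  | n + 1 => c (derivedSeq c n) (derivedSeq c n)

/-- The lower central series `λ₁ = 1, λ_{n+1} = [1, λ_n]` (indexed from 0). -/
def lowerCentralSeq {L : Type*} [CompleteLattice L] (c : L → L → L) : ℕ → L
  | 0 => ⊤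
  | n + 1 => c ⊤ (lowerCentralSeq c n)

/-- A commutator lattice is of solvable type if its derived series reaches `0`. -/
def SolvableType {L : Type*} [CompleteLattice L] (c : L → L → L) : Prop :=
  ∃ n, derivedSeq c n = ⊥

/-- A commutator lattice is of nilpotent type if its lower central series reaches `0`. -/
def NilpotentType {L : Type*} [CompleteLattice L] (c : L → L → L) : Prop :=
  ∃ n, lowerCentralSeq c n = ⊥

/-- `L` forces abelian type if `⌊1,1⌋ = 0`. -/
def ForcesAbelianType (L : Type*) [CompleteLattice L] : Prop := lcomm (⊤ : L) ⊤ = ⊥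

/-- `L` forces nilpotent type. -/
def ForcesNilpotentType (L : Type*) [CompleteLattice L] : Prop :=
  NilpotentType (lcomm : L → L → L)

/-- `L` forces solvable type. -/
def ForcesSolvableType (L : Type*) [CompleteLattice L] : Prop :=
  SolvableType (lcomm : L → L → L)

/-- `e` realizes `L` as a complete sublattice of `K`: `e` is injective and preserves
arbitrary nonempty joins and meets. -/
def IsCompleteSublatticeEmb {L K : Type*} [CompleteLattice L] [CompleteLattice K]
    (e : L → K) : Prop :=
  Function.Injective e ∧
  (∀ S : Set L, S.Nonempty → e (sSup S) = sSup (e '' S)) ∧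
  (∀ S : Set L, S.Nonempty → e (sInf S) = sInf (e '' S))

/-- A complete lattice homomorphism: preserves arbitrary joins and arbitrary meets. -/
def IsCompleteLatticeHom {L K : Type*} [CompleteLattice L] [CompleteLattice K]
    (h : L → K) : Prop :=
  (∀ S : Set L, h (sSup S) = sSup (h '' S)) ∧
  (∀ S : Set L, h (sInf S) = sInf (h '' S))

/-- A lattice has finite height if there is a finite bound on the lengths of its chains. -/
def FiniteHeight (L : Type*) [Preorder L] : Prop :=
  ∃ n : ℕ, ∀ l : List L, l.Chain' (· < ·) → l.length ≤ n

/-- A lattice congruence: an equivalence relation compatible with `⊔` and `⊓`. -/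
def IsLatticeCongruence {L : Type*} [Lattice L] (Θ : L → L → Prop) : Prop :=
  Equivalence Θ ∧
  ∀ a b x y : L, Θ a b → Θ x y → Θ (a ⊔ x) (b ⊔ y) ∧ Θ (a ⊓ x) (b ⊓ y)

/-- A lattice is simple if its only lattice congruences are equality and the all relation. -/
def SimpleLattice (L : Type*) [Lattice L] : Prop :=
  ∀ Θ : L → L → Prop, IsLatticeCongruence Θ →
    (∀ a b : L, Θ a b ↔ a = b) ∨ (∀ a b : L, Θ a b)

namespace IsCommutatorMult

variable {L : Type*} [CompleteLattice L] {c : L → L → L}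

theorem sup_right (hc : IsCommutatorMult c) (z x y : L) : c z (x ⊔ y) = c z x ⊔ c z y := by
  rw [hc.1 z, ← sSup_pair, hc.2.2, iSup_pair, hc.1 x, hc.1 y]

/-- Multiplying by `z` annihilates `[p.1, p.2]` iff it annihilates a transpose of it. -/
theorem le_iff_of_transUp (hc : IsCommutatorMult c) {p q : L × L} (h : TransUp p q) (z : L) :
    c z p.2 ≤ p.1 ↔ c z q.2 ≤ q.1 := by
  have hp : c z p.2 ≤ p.2 := (hc.2.1 _ _).trans inf_le_right
  have hq : c z q.1 ≤ q.1 := (hc.2.1 _ _).trans inf_le_right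
  simp only [h.1, h.2, hc.sup_right, le_inf_iff, sup_le_iff, hp, hq, true_and, and_true]

theorem self_le_iff_of_transUp (hc : IsCommutatorMult c) {p q : L × L} (h : TransUp p q) :
    c p.2 p.2 ≤ p.1 ↔ c q.2 q.2 ≤ q.1 := by
  have hq : c p.2 q.1 ≤ q.1 := (hc.2.1 _ _).trans inf_le_right
  rw [← hc.le_iff_of_transUp h q.2, hc.1 q.2, h.1, hc.sup_right, sup_le_iff, h.2]
  exact ⟨fun hp => ⟨hp, le_inf ((hc.2.1 _ _).trans inf_le_left) hq⟩, And.left⟩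

theorem le_iff_of_projIntv (hc : IsCommutatorMult c) {p q : L × L} (h : ProjIntv p q) (z : L) :
    c z p.2 ≤ p.1 ↔ c z q.2 ≤ q.1 := by
  induction h with
  | rel _ _ h => exact hc.le_iff_of_transUp h z
  | refl => rfl
  | symm _ _ _ ih => exact ih.symm
  | trans _ _ _ _ _ ih₁ ih₂ => exact ih₁.trans ih₂

theorem self_le_iff_of_projIntv (hc : IsCommutatorMult c) {p q : L × L} (h : ProjIntv p q) :
    c p.2 p.2 ≤ p.1 ↔ c q.2 q.2 ≤ q.1 := by
  induction h with
  | rel _ _ h => exact hc.self_le_iff_of_transUp h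
  | refl => rfl
  | symm _ _ _ ih => exact ih.symm
  | trans _ _ _ _ _ ih₁ ih₂ => exact ih₁.trans ih₂

end IsCommutatorMult

/-- residuation and squares are invariant under projectivity of intervals. -/
theorem statement1 {L : Type*} [CompleteLattice L] (c : L → L → L)
    (hc : IsCommutatorMult c) (α β γ δ : L) (hαβ : α ≤ β) (hγδ : γ ≤ δ)
    (hproj : ProjIntv (α, β) (γ, δ)) :
    resid c α β = resid c γ δ ∧ (c β β ≤ α ↔ c δ δ ≤ γ) := by
  refine ⟨?_, hc.self_le_iff_of_projIntv hproj⟩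
  exact congrArg sSup (Set.ext fun z => hc.le_iff_of_projIntv hproj z)
end

section
/- Let L be a complete lattice equipped with a commutator multiplication [·,·], with associated residuation (·:·). Let α, β ∈ L with α ≺ β (α is a subcover of β). Then Γ(α,β) ≤ (α : β). -/
/-- A commutator multiplication distributes over binary joins in its second argument. -/
theorem IsCommutatorMult.apply_sup {L : Type*} [CompleteLattice L] {c : L → L → L}
    (hc : IsCommutatorMult c) (z x y : L) : c z (x ⊔ y) = c z x ⊔ c z y := by
  rw [hc.1 z (x ⊔ y), hc.1 z x, hc.1 z y, ← sSup_pair, hc.2.2, iSup_pair]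

/-- Centralization of an interval is invariant under upward transposition. -/
theorem TransUp.commutator_le_iff {L : Type*} [CompleteLattice L] {c : L → L → L}
    (hc : IsCommutatorMult c) {p q : L × L} (h : TransUp p q) (z : L) :
    c z p.2 ≤ p.1 ↔ c z q.2 ≤ q.1 := by
  obtain ⟨h₂, h₁⟩ := h
  rw [h₂, h₁, hc.apply_sup]
  constructor
  · exact fun hz => sup_le (hz.trans inf_le_right) ((hc.2.1 z q.1).trans inf_le_right)
  · exact fun hz => le_inf ((hc.2.1 z p.2).trans inf_le_right) (le_sup_left.trans hz)

/-- Centralization of an interval is invariant under projectivity. -/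
theorem ProjIntv.commutator_le_iff {L : Type*} [CompleteLattice L] {c : L → L → L}
    (hc : IsCommutatorMult c) {p q : L × L} (h : ProjIntv p q) (z : L) :
    c z p.2 ≤ p.1 ↔ c z q.2 ≤ q.1 := by
  induction h with
  | rel p q h => exact h.commutator_le_iff hc z
  | refl p => exact Iff.rfl
  | symm p q _ ih => exact ih.symm
  | trans p q r _ _ ih₁ ih₂ => exact ih₁.trans ih₂

/-- `Γ(α,β)` is a lower bound for the residuum `(α : β)`. -/
theorem statement2 {L : Type*} [CompleteLattice L] (c : L → L → L)
    (hc : IsCommutatorMult c) (α β : L) (h : α ⋖ β) :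
    GammaEl α β ≤ resid c α β := by
  refine sSup_le fun η hη => le_sSup ?_
  exact (hη.2.commutator_le_iff hc η).1 ((hc.2.1 η (mplus η)).trans inf_le_left)
end

section
/- Let L be a complete lattice, let K be a complete lattice equipped with a commutator multiplication [·,·]_K, and let h : L → K be a complete lattice homomorphism (preserving arbitrary joins and meets). For x, y ∈ L define [x,y]_L := ⋀{ z ∈ L : h(z) ≥ [h(x), h(y)]_K }. Then [·,·]_L is a commutator multiplication on L, and h([x,y]_L) ≥ [h(x), h(y)]_K for all x, y ∈ L. -/
theorem IsCompleteLatticeHom.monotone {L K : Type*} [CompleteLattice L] [CompleteLattice K]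
    {h : L → K} (hh : IsCompleteLatticeHom h) : Monotone h := by
  intro a b hab
  have hsup := hh.1 {a, b}
  rw [sSup_pair, sup_eq_right.mpr hab, Set.image_pair, sSup_pair] at hsup
  exact hsup ▸ le_sup_left

/-- A complete lattice homomorphism has a lower adjoint `k ↦ ⋀ { z | k ≤ h z }`. -/
theorem IsCompleteLatticeHom.gc_sInf {L K : Type*} [CompleteLattice L] [CompleteLattice K]
    {h : L → K} (hh : IsCompleteLatticeHom h) :
    GaloisConnection (fun k : K => sInf {z : L | k ≤ h z}) h := by
  refine fun k w => ⟨fun hw => le_trans ?_ (hh.monotone hw), fun hw => sInf_le hw⟩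
  rw [hh.2]
  exact le_sInf (Set.forall_mem_image.mpr fun z hz => hz)

/-- pulling back a commutator multiplication along a complete lattice
homomorphism yields a commutator multiplication. -/
theorem statement6 {L K : Type*} [CompleteLattice L] [CompleteLattice K]
    (h : L → K) (hh : IsCompleteLatticeHom h)
    (cK : K → K → K) (hcK : IsCommutatorMult cK)
    (cL : L → L → L)
    (hcL : ∀ x y : L, cL x y = sInf {z : L | cK (h x) (h y) ≤ h z}) :
    IsCommutatorMult cL ∧ ∀ x y : L, cK (h x) (h y) ≤ h (cL x y) := by
  have gc (x y w : L) : cL x y ≤ w ↔ cK (h x) (h y) ≤ h w := by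
    rw [hcL]
    exact hh.gc_sInf (cK (h x) (h y)) w
  obtain ⟨comm, le_meet, sSup_dist⟩ := hcK
  refine ⟨⟨fun x y => by rw [hcL, hcL, comm], fun x y => le_inf ?_ ?_, fun S y => ?_⟩,
    fun x y => (gc x y _).mp le_rfl⟩
  · exact (gc x y x).mpr ((le_meet _ _).trans inf_le_left)
  · exact (gc x y y).mpr ((le_meet _ _).trans inf_le_right)
  · refine eq_of_forall_ge_iff fun w => ?_
    rw [gc, hh.1, sSup_dist, iSup_image]
    simp only [iSup_le_iff, gc]
end

section
/- Let L be a complete lattice that splits with splitting pair (δ, ε). Let Θ be a complete congruence of L with (ε, 1) ∈ Θ, and define s : L → L by s(x) := ⋀{ z ∈ L : (z, x) ∈ Θ }. For x, y ∈ L define [x,y] := 0 if x ≤ δ and y ≤ δ, and [x,y] := s(x ∧ y) otherwise. Then: (1) if x ≰ δ, then [x,y] = [y,x] = s(y); (2) [·,·] is a commutator multiplication on L. -/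
namespace IsCompleteCongruence

variable {L : Type*} [CompleteLattice L] {Θ : L → L → Prop}

theorem sup (hΘ : IsCompleteCongruence Θ) {a b x y : L} (hab : Θ a b) (hxy : Θ x y) :
    Θ (a ⊔ x) (b ⊔ y) := by
  have h := (hΘ.2 {(a, b), (x, y)} (by rintro p (rfl | rfl) <;> assumption)).1
  simpa only [iSup_insert, iSup_singleton] using h

theorem inf (hΘ : IsCompleteCongruence Θ) {a b x y : L} (hab : Θ a b) (hxy : Θ x y) :
    Θ (a ⊓ x) (b ⊓ y) := by
  have h := (hΘ.2 {(a, b), (x, y)} (by rintro p (rfl | rfl) <;> assumption)).2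
  simpa only [iInf_insert, iInf_singleton] using h

theorem biSup (hΘ : IsCompleteCongruence Θ) {S : Set L} {f g : L → L}
    (h : ∀ x ∈ S, Θ (f x) (g x)) : Θ (⨆ x ∈ S, f x) (⨆ x ∈ S, g x) := by
  have h' := (hΘ.2 ((fun x => (f x, g x)) '' S) (by rintro _ ⟨x, hx, rfl⟩; exact h x hx)).1
  simpa only [iSup_image] using h'

theorem biInf (hΘ : IsCompleteCongruence Θ) {S : Set L} {f g : L → L}
    (h : ∀ x ∈ S, Θ (f x) (g x)) : Θ (⨅ x ∈ S, f x) (⨅ x ∈ S, g x) := by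
  have h' := (hΘ.2 ((fun x => (f x, g x)) '' S) (by rintro _ ⟨x, hx, rfl⟩; exact h x hx)).2
  simpa only [iInf_image] using h'

/-- Every element is congruent to the meet of its class. -/
theorem rel_sInf_class (hΘ : IsCompleteCongruence Θ) (x : L) : Θ (sInf {z | Θ z x}) x := by
  have h := hΘ.biInf (S := {z | Θ z x}) (f := id) (g := fun _ => x) fun _ hz => hz
  rw [biInf_const (show {z | Θ z x}.Nonempty from ⟨x, hΘ.1.refl x⟩)] at h
  rwa [sInf_eq_iInf]

theorem sInf_class_le (hΘ : IsCompleteCongruence Θ) (x : L) : sInf {z | Θ z x} ≤ x :=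
  sInf_le (hΘ.1.refl x)

theorem sInf_class_congr (hΘ : IsCompleteCongruence Θ) {x y : L} (hxy : Θ x y) :
    sInf {z | Θ z x} = sInf {z | Θ z y} :=
  congrArg sInf (Set.ext fun _ => ⟨fun h => hΘ.1.trans h hxy,
    fun h => hΘ.1.trans h (hΘ.1.symm hxy)⟩)

theorem sInf_class_mono (hΘ : IsCompleteCongruence Θ) {x y : L} (hxy : x ≤ y) :
    sInf {z | Θ z x} ≤ sInf {z | Θ z y} := by
  have h := hΘ.inf (hΘ.rel_sInf_class y) (hΘ.1.refl x)
  rw [inf_eq_right.2 hxy] at h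
  exact (sInf_le (show _ ∈ {z | Θ z x} from h)).trans inf_le_left

theorem sInf_class_sSup (hΘ : IsCompleteCongruence Θ) (S : Set L) :
    sInf {z | Θ z (sSup S)} = ⨆ x ∈ S, sInf {z | Θ z x} := by
  refine le_antisymm (sInf_le ?_) (iSup₂_le fun x hx => hΘ.sInf_class_mono (le_sSup hx))
  rw [Set.mem_ofPred_eq, sSup_eq_iSup]
  exact hΘ.biSup fun x _ => hΘ.rel_sInf_class x

theorem rel_top_of_le (hΘ : IsCompleteCongruence Θ) {a x : L} (ha : Θ a ⊤) (hax : a ≤ x) :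
    Θ x ⊤ := by
  have h := hΘ.sup ha (hΘ.1.refl x)
  rwa [sup_eq_right.2 hax, top_sup_eq] at h

end IsCompleteCongruence

/-- a commutator multiplication constructed from a splitting pair and a
complete congruence. -/
theorem statement7 {L : Type*} [CompleteLattice L] (δ ε : L)
    (hδ : δ < ⊤) (hε : ⊥ < ε) (hsplit : ∀ α : L, α ≤ δ ∨ ε ≤ α)
    (Θ : L → L → Prop) (hΘ : IsCompleteCongruence Θ) (hεΘ : Θ ε ⊤)
    (s : L → L) (hs : ∀ x : L, s x = sInf {z : L | Θ z x})
    (c : L → L → L)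
    (hc₁ : ∀ x y : L, x ≤ δ → y ≤ δ → c x y = ⊥)
    (hc₂ : ∀ x y : L, ¬ (x ≤ δ ∧ y ≤ δ) → c x y = s (x ⊓ y)) :
    (∀ x y : L, ¬ x ≤ δ → c x y = s y ∧ c y x = s y) ∧
    IsCommutatorMult c := by
  obtain rfl : s = fun x => sInf {z | Θ z x} := funext hs
  have hl : ∀ x y : L, ¬ x ≤ δ → c x y = sInf {z | Θ z y} := by
    intro x y hx
    rw [hc₂ x y fun h => hx h.1]
    have h := hΘ.inf (hΘ.rel_top_of_le hεΘ ((hsplit x).resolve_left hx)) (hΘ.1.refl y)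
    rw [top_inf_eq] at h
    exact hΘ.sInf_class_congr h
  have hcomm : ∀ x y : L, c x y = c y x := by
    intro x y
    by_cases h : x ≤ δ ∧ y ≤ δ
    · rw [hc₁ x y h.1 h.2, hc₁ y x h.2 h.1]
    · rw [hc₂ x y h, hc₂ y x fun h' => h h'.symm, inf_comm]
  refine ⟨fun x y hx => ⟨hl x y hx, (hcomm y x).trans (hl x y hx)⟩, hcomm, ?_, ?_⟩
  · intro x y
    by_cases h : x ≤ δ ∧ y ≤ δ
    · rw [hc₁ x y h.1 h.2]
      exact bot_le
    · rw [hc₂ x y h]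
      exact hΘ.sInf_class_le _
  · intro S y
    by_cases hy : y ≤ δ
    · by_cases hS : sSup S ≤ δ
      · rw [hc₁ _ _ hS hy, eq_comm, iSup₂_eq_bot]
        exact fun x hx => hc₁ x y ((le_sSup hx).trans hS) hy
      · rw [hl _ _ hS]
        obtain ⟨x, hx, hxδ⟩ : ∃ x ∈ S, ¬ x ≤ δ := by
          simpa only [sSup_le_iff, not_forall, exists_prop] using hS
        refine le_antisymm ((hl x y hxδ).ge.trans (le_iSup₂_of_le x hx le_rfl))
          (iSup₂_le fun w _ => ?_)
        by_cases hw : w ≤ δ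
        · rw [hc₁ w y hw hy]
          exact bot_le
        · exact (hl w y hw).le
    · simp only [fun x => (hcomm x y).trans (hl y x hy)]
      exact hΘ.sInf_class_sSup S
end

section
/- Let L be a bialgebraic modular lattice, and let a, b ∈ L with a ≺ b. Define Φ := { (x,y) ∈ L × L : the interval [a,b] does not project into [x ∧ y, x ∨ y] }. Then Φ is a complete congruence on L. -/
section Projection

variable {L : Type*}

theorem TransUp.covBy_iff [Lattice L] [IsModularLattice L] {p q : L × L} (h : TransUp p q) :
    p.1 ⋖ p.2 ↔ q.1 ⋖ q.2 := by
  rw [h.1, h.2]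
  exact ⟨covBy_sup_of_inf_covBy_left, fun h' => inf_covBy_of_covBy_sup_right h'⟩

theorem ProjIntv.covBy_iff [Lattice L] [IsModularLattice L] {p q : L × L} (h : ProjIntv p q) :
    p.1 ⋖ p.2 ↔ q.1 ⋖ q.2 := by
  induction h with
  | rel _ _ h => exact h.covBy_iff
  | refl _ => rfl
  | symm _ _ _ ih => exact ih.symm
  | trans _ _ _ _ _ ih₁ ih₂ => exact ih₁.trans ih₂

theorem ProjIntv.dual [Lattice L] {p q : L × L} (h : ProjIntv p q) :
    ProjIntv (OrderDual.toDual p.2, OrderDual.toDual p.1)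
      (OrderDual.toDual q.2, OrderDual.toDual q.1) := by
  induction h with
  | rel p q h =>
    exact .symm _ _ (.rel _ _ ⟨h.2.trans (inf_comm _ _), h.1.trans (sup_comm _ _)⟩)
  | refl _ => exact .refl _
  | symm _ _ _ ih => exact ih.symm
  | trans _ _ _ _ _ ih₁ ih₂ => exact ih₁.trans _ _ _ ih₂

/-- If a prime interval `[u, v]` does not transpose down into `[u ⊓ d, v ⊓ d]`, then the meet of
`v` with `d` lies below `u`. -/
theorem inf_le_or_transUp_of_covBy [Lattice L] {u v : L} (huv : u ⋖ v) (d : L) :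
    v ⊓ d ≤ u ∨ TransUp (u ⊓ d, v ⊓ d) (u, v) := by
  rcases huv.eq_or_eq (le_sup_left : u ≤ u ⊔ v ⊓ d) (sup_le huv.le inf_le_left) with h | h
  · exact .inl (sup_eq_left.1 h)
  · refine .inr ⟨?_, ?_⟩
    · exact (sup_comm _ _).trans h |>.symm
    · change u ⊓ d = v ⊓ d ⊓ u
      rw [inf_right_comm, inf_eq_right.2 huv.le]

variable [CompleteLattice L] {a b c d e x y z : L}

theorem ProjInto.dual (h : ProjInto a b c d) :
    ProjInto (OrderDual.toDual b) (OrderDual.toDual a)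
      (OrderDual.toDual d) (OrderDual.toDual c) := by
  obtain ⟨u, v, hcu, huv, hvd, hp⟩ := h
  exact ⟨OrderDual.toDual v, OrderDual.toDual u, hvd, huv, hcu, hp.dual⟩

theorem ProjInto.mono (h : ProjInto a b c d) (hc : x ≤ c) (hd : d ≤ y) : ProjInto a b x y := by
  obtain ⟨u, v, hcu, huv, hvd, hp⟩ := h
  exact ⟨u, v, hc.trans hcu, huv, hvd.trans hd, hp⟩

variable [IsModularLattice L]

theorem not_projInto_self (hab : a ⋖ b) : ¬ ProjInto a b c c := by
  rintro ⟨u, v, hcu, -, hvc, hp⟩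
  exact (hp.covBy_iff.1 hab).lt.not_ge (hvc.trans hcu)

theorem ProjInto.inf_of_sup (h : ProjInto a b d (c ⊔ d)) : ProjInto a b (c ⊓ d) c := by
  obtain ⟨u, v, hdu, huv, hvd, hp⟩ := h
  refine ⟨c ⊓ u, c ⊓ v, inf_le_inf_left _ hdu, inf_le_inf_left _ huv, inf_le_left,
    hp.trans _ _ _ (.symm _ _ (.rel _ _ ⟨?_, ?_⟩))⟩
  · change v = c ⊓ v ⊔ u
    apply le_antisymm _ (sup_le inf_le_right huv)
    rw [sup_comm, inf_comm, inf_comm, ← sup_inf_assoc_of_le c huv]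
    refine le_inf (hvd.trans ?_) le_rfl
    exact sup_le le_sup_right (hdu.trans le_sup_left)
  · change c ⊓ u = c ⊓ v ⊓ u
    rw [inf_assoc, inf_eq_right.2 huv]

theorem ProjInto.of_sup_right (hxy : x ≤ y) (h : ProjInto a b (x ⊔ z) (y ⊔ z)) :
    ProjInto a b x y := by
  rw [show y ⊔ z = y ⊔ (x ⊔ z) by rw [← sup_assoc, sup_eq_left.2 hxy]] at h
  exact h.inf_of_sup.mono (le_inf hxy le_sup_left) le_rfl

theorem ProjInto.of_inf_right (hxy : x ≤ y) (h : ProjInto a b (x ⊓ z) (y ⊓ z)) :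
    ProjInto a b x y :=
  (ProjInto.of_sup_right (x := OrderDual.toDual y) (y := OrderDual.toDual x)
    (z := OrderDual.toDual z) hxy h.dual).dual

theorem ProjInto.split (hab : a ⋖ b) (hcd : c ≤ d) (hde : d ≤ e) (h : ProjInto a b c e) :
    ProjInto a b c d ∨ ProjInto a b d e := by
  obtain ⟨u, v, hcu, huv, hve, hp⟩ := h
  rcases inf_le_or_transUp_of_covBy (hp.covBy_iff.1 hab) d with h | h
  · refine .inr ⟨u ⊔ d, v ⊔ d, le_sup_right, sup_le_sup_right huv _, sup_le hve hde,
      hp.trans _ _ _ (.rel _ _ ⟨?_, ?_⟩)⟩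
    · change v ⊔ d = v ⊔ (u ⊔ d)
      rw [← sup_assoc, sup_eq_left.2 huv]
    · change u = v ⊓ (u ⊔ d)
      rw [inf_comm, sup_inf_assoc_of_le d huv, inf_comm, sup_eq_left.2 h]
  · exact .inl ⟨u ⊓ d, v ⊓ d, le_inf hcu hcd, inf_le_inf_right _ huv, inf_le_right,
      hp.trans _ _ _ (.symm _ _ (.rel _ _ h))⟩

theorem not_projInto_trans (hab : a ⋖ b) (hxy : ¬ ProjInto a b (x ⊓ y) (x ⊔ y))
    (hyz : ¬ ProjInto a b (y ⊓ z) (y ⊔ z)) : ¬ ProjInto a b (x ⊓ z) (x ⊔ z) := by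
  intro h
  have h' : ProjInto a b (x ⊓ y ⊓ (y ⊓ z)) (x ⊔ y ⊔ (y ⊔ z)) :=
    h.mono (le_inf (inf_le_left.trans inf_le_left) (inf_le_right.trans inf_le_right))
      (sup_le (le_sup_left.trans le_sup_left) (le_sup_right.trans le_sup_right))
  rcases h'.split hab (inf_le_left.trans inf_le_right : _ ≤ y) (le_sup_right.trans le_sup_left)
    with h | h
  · rcases h.split hab inf_le_left inf_le_right with h | h
    · refine hyz (ProjInto.mono (d := y) ?_ le_rfl le_sup_left)
      refine ProjInto.of_inf_right (z := x ⊓ y) inf_le_left (h.mono ?_ ?_)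
      · rw [inf_comm]
      · exact le_inf inf_le_right le_rfl
    · exact hxy (h.mono le_rfl le_sup_right)
  · rcases h.split hab le_sup_right le_sup_left with h | h
    · exact hxy (h.mono inf_le_right le_rfl)
    · refine hyz (ProjInto.mono (c := y) ?_ inf_le_left le_rfl)
      refine ProjInto.of_sup_right (z := x ⊔ y) le_sup_left (h.mono ?_ ?_)
      · exact sup_le le_sup_right le_rfl
      · rw [sup_comm]

theorem not_projInto_sSup_of_directedOn [IsCompactlyGenerated L] (hab : a ⋖ b) {I : Set L}
    (hI : DirectedOn (· ≤ ·) I) (hc : ∀ e ∈ I, c ≤ e) (h : ∀ e ∈ I, ¬ ProjInto a b c e) :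
    ¬ ProjInto a b c (sSup I) := by
  rintro ⟨u, v, hcu, huv, hv, hp⟩
  have huv' : u ⋖ v := hp.covBy_iff.1 hab
  refine huv'.lt.not_ge ?_
  rw [← inf_eq_left.2 hv, hI.inf_sSup_eq]
  refine iSup₂_le fun e he => (inf_le_or_transUp_of_covBy huv' e).resolve_right fun ht => h e he ?_
  exact ⟨u ⊓ e, v ⊓ e, le_inf hcu (hc e he), inf_le_inf_right _ huv, inf_le_right,
    hp.trans _ _ _ (.symm _ _ (.rel _ _ ht))⟩

theorem not_projInto_iSup [IsCompactlyGenerated L] (hab : a ⋖ b) {ι : Sort*} {f g : ι → L}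
    (hfg : ∀ i, f i ≤ g i) (h : ∀ i, ¬ ProjInto a b (f i) (g i)) :
    ¬ ProjInto a b (⨆ i, f i) (⨆ i, g i) := by
  set c := ⨆ i, f i with hc
  let I : Set L := {e | c ≤ e ∧ ¬ ProjInto a b c e}
  have hI : DirectedOn (· ≤ ·) I := by
    rintro d ⟨hcd, hd⟩ e ⟨hce, he⟩
    refine ⟨d ⊔ e, ⟨hcd.trans le_sup_left, fun hp => ?_⟩, le_sup_left, le_sup_right⟩
    rcases hp.split hab hcd le_sup_left with hp | hp
    · exact hd hp
    · refine he (ProjInto.of_sup_right (z := d) hce (hp.mono ?_ ?_))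
      · exact sup_le hcd le_rfl
      · rw [sup_comm]
  refine fun hp => not_projInto_sSup_of_directedOn hab hI (fun _ he => he.1) (fun _ he => he.2)
    (hp.mono le_rfl (iSup_le fun i => ?_))
  refine le_sup_left.trans (le_sSup (a := g i ⊔ c) ⟨le_sup_right, fun hp' => h i ?_⟩)
  refine ProjInto.of_sup_right (z := c) (hfg i) (hp'.mono ?_ le_rfl)
  exact sup_le (le_iSup f i) le_rfl

theorem not_projInto_iInf [IsCompactlyGenerated Lᵒᵈ] (hab : a ⋖ b) {ι : Sort*} {f g : ι → L}
    (hfg : ∀ i, f i ≤ g i) (h : ∀ i, ¬ ProjInto a b (f i) (g i)) :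
    ¬ ProjInto a b (⨅ i, f i) (⨅ i, g i) := fun hp =>
  not_projInto_iSup (L := Lᵒᵈ) hab.toDual (f := fun i => OrderDual.toDual (g i))
    (g := fun i => OrderDual.toDual (f i)) hfg (fun i hi => h i hi.dual) hp.dual

end Projection

/-- in a bialgebraic modular lattice, the relation "the prime interval
`[a,b]` does not project into `[x ⊓ y, x ⊔ y]`" is a complete congruence. -/
theorem statement8 {L : Type*} [CompleteLattice L] [IsModularLattice L]
    [IsCompactlyGenerated L] [IsCompactlyGenerated Lᵒᵈ]
    (a b : L) (hab : a ⋖ b) :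
    IsCompleteCongruence (fun x y : L => ¬ ProjInto a b (x ⊓ y) (x ⊔ y)) := by
  refine ⟨⟨fun x => ?_, fun {x y} h => ?_, fun h₁ h₂ => not_projInto_trans hab h₁ h₂⟩,
    fun S hS => ⟨fun h => ?_, fun h => ?_⟩⟩
  · rw [inf_idem, sup_idem]
    exact not_projInto_self hab
  · rwa [inf_comm, sup_comm]
  · simp only [iSup_subtype'] at h
    refine not_projInto_iSup hab (ι := S) (fun p => inf_le_sup) (fun p => hS p p.2) (h.mono ?_ ?_)
    · exact le_inf (iSup_mono fun _ => inf_le_left) (iSup_mono fun _ => inf_le_right)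
    · rw [iSup_sup_eq]
  · simp only [iInf_subtype'] at h
    refine not_projInto_iInf hab (ι := S) (fun p => inf_le_sup) (fun p => hS p p.2) (h.mono ?_ ?_)
    · rw [iInf_inf_eq]
    · exact sup_le (iInf_mono fun _ => le_sup_left) (iInf_mono fun _ => le_sup_right)
end

section
/- Let L be an algebraic modular lattice, and let α, β ∈ L with α ≺ β. Then for every φ ∈ L, either φ ≤ Γ(α,β) or φ ≥ Δ(α,β). -/
/-- In a compactly generated lattice, join irreducible elements are compact. -/
theorem JoinIrred.isCompactElement {L : Type*} [CompleteLattice L] [IsCompactlyGenerated L]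
    {ρ : L} (hρ : JoinIrred ρ) : IsCompactElement ρ := by
  by_contra hc
  refine hρ.not_ge ?_
  rw [le_iff_compact_le_imp]
  intro c hcc hcρ
  refine le_sSup (lt_of_le_of_ne hcρ ?_)
  rintro rfl
  exact hc hcc

/-- An element not above a compact `k` extends to a maximal element not above `k`. -/
theorem exists_maximal_not_le_of_isCompactElement {L : Type*} [CompleteLattice L] {k x : L}
    (hk : IsCompactElement k) (hx : ¬ k ≤ x) :
    ∃ η, x ≤ η ∧ Maximal (fun y => ¬ k ≤ y) η := by
  refine zorn_le_nonempty₀ {y | ¬ k ≤ y} ?_ x hx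
  intro C hC hchain y hy
  refine ⟨sSup C, fun hle => ?_, fun z hz => le_sSup hz⟩
  obtain ⟨z, hz, hkz⟩ := (CompleteLattice.isCompactElement_iff_le_of_directed_sSup_le L k).1 hk C
    ⟨y, hy⟩ hchain.directedOn hle
  exact hC hz hkz

/-- If `η` is maximal among the elements not above `ρ`, then `η⁺ = ρ ⊔ η`. -/
theorem mplus_eq_sup_of_maximal {L : Type*} [CompleteLattice L] {ρ η : L}
    (hη : Maximal (fun y => ¬ ρ ≤ y) η) : mplus η = ρ ⊔ η := by
  refine le_antisymm (sInf_le (right_lt_sup.2 hη.prop)) (le_sInf fun β hβ => ?_)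
  refine sup_le ?_ (le_of_lt hβ)
  by_contra hn
  exact (lt_of_lt_of_le hβ (hη.le_of_ge hn (le_of_lt hβ))).false

/-- `(Γ(α,β), Δ(α,β))` splits an algebraic modular lattice. -/
theorem statement10 {L : Type*} [CompleteLattice L] [IsModularLattice L]
    [IsCompactlyGenerated L]
    (α β : L) (h : α ⋖ β) (φ : L) :
    φ ≤ GammaEl α β ∨ DeltaEl α β ≤ φ := by
  refine or_iff_not_imp_right.2 fun hΔ => ?_
  obtain ⟨ρ, ⟨hρ, hproj⟩, hρφ⟩ : ∃ ρ, (JoinIrred ρ ∧ ProjIntv (jminus ρ, ρ) (α, β)) ∧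
      ¬ ρ ≤ φ := by
    by_contra! hn
    exact hΔ (sSup_le hn)
  have hlt_le : ∀ x, ¬ ρ ≤ x → ρ ⊓ x ≤ jminus ρ := fun x hx => le_sSup (inf_lt_left.2 hx)
  have hsup : ¬ ρ ≤ jminus ρ ⊔ φ := fun hle => hρ.not_ge <| calc
    ρ ≤ (jminus ρ ⊔ φ) ⊓ ρ := le_inf hle le_rfl
    _ ≤ jminus ρ ⊔ φ ⊓ ρ := sup_inf_le_assoc_of_le φ hρ.le
    _ ≤ jminus ρ := sup_le le_rfl (inf_comm ρ φ ▸ hlt_le φ hρφ)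
  obtain ⟨η, hle, hη⟩ := exists_maximal_not_le_of_isCompactElement hρ.isCompactElement hsup
  have hplus := mplus_eq_sup_of_maximal hη
  have htrans : TransUp (jminus ρ, ρ) (η, mplus η) :=
    ⟨hplus, le_antisymm (le_inf hρ.le (le_sup_left.trans hle)) (hlt_le η hη.prop)⟩
  refine (le_sup_right.trans hle).trans (le_sSup ⟨?_, ?_⟩)
  · rw [MeetIrred, hplus]
    exact right_lt_sup.2 hη.prop
  · exact ((Relation.EqvGen.rel _ _ htrans).symm).trans _ _ _ hproj
end

section
/- Let L be a bialgebraic modular lattice, let α, β ∈ L with α ≺ β, and let η ∈ M(L) with [α,β] ⟷ [η,η⁺]. Then the following are equivalent: (1) η is a lonesome meet irreducible element; (2) η is completely meet prime, i.e., for every subset X ⊆ L with ⋀X ≤ η there exists x ∈ X with x ≤ η; (3) there is a complete lattice homomorphism h from L onto the two-element lattice {0,1} with h(α) = h(η) = 0 and h(β) = h(η⁺) = 1. -/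
/-- In a compactly generated lattice, a completely join irreducible element is inaccessible by
directed joins. -/
theorem exists_le_of_le_sSup_of_directedOn {L : Type*} [CompleteLattice L]
    [IsCompactlyGenerated L] {ρ σ : L} (hσ : σ < ρ) (h : ∀ z, z < ρ → z ≤ σ)
    {D : Set L} (hD : DirectedOn (· ≤ ·) D) (hle : ρ ≤ sSup D) : ∃ d ∈ D, ρ ≤ d := by
  by_contra! hcon
  refine hσ.not_ge ?_
  rw [← inf_eq_left.2 hle, hD.inf_sSup_eq]
  exact iSup₂_le fun d hd => h _ (inf_lt_left.2 (hcon d hd))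

/-- Dual of `exists_le_of_le_sSup_of_directedOn`. -/
theorem exists_le_of_sInf_le_of_directedOn {L : Type*} [CompleteLattice L]
    [IsCompactlyGenerated Lᵒᵈ] {η θ : L} (hθ : η < θ) (h : ∀ z, η < z → θ ≤ z)
    {D : Set L} (hD : DirectedOn (· ≥ ·) D) (hle : sInf D ≤ η) : ∃ d ∈ D, d ≤ η :=
  exists_le_of_le_sSup_of_directedOn (L := Lᵒᵈ) (ρ := OrderDual.toDual η)
    (σ := OrderDual.toDual θ) hθ h (D := OrderDual.ofDual ⁻¹' D) hD hle

/-- Above every `y` not above `ρ` there is an element maximal among those not above `ρ`. -/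
theorem exists_maximal_not_ge {L : Type*} [CompleteLattice L]
    [IsCompactlyGenerated L] {ρ σ : L} (hσ : σ < ρ) (h : ∀ z, z < ρ → z ≤ σ)
    {y : L} (hy : ¬ ρ ≤ y) : ∃ φ, y ≤ φ ∧ Maximal (fun z => ¬ ρ ≤ z) φ := by
  refine zorn_le_nonempty₀ {z | ¬ ρ ≤ z} (fun c hc hchain _ _ => ⟨sSup c, ?_, ?_⟩) y hy
  · intro hle
    obtain ⟨d, hd, hρd⟩ := exists_le_of_le_sSup_of_directedOn hσ h hchain.directedOn hle
    exact hc hd hρd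
  · exact fun z hz => le_sSup hz

/-- Dual of `exists_maximal_not_ge`. -/
theorem exists_minimal_not_le {L : Type*} [CompleteLattice L]
    [IsCompactlyGenerated Lᵒᵈ] {η θ : L} (hθ : η < θ) (h : ∀ z, η < z → θ ≤ z)
    {x : L} (hx : ¬ x ≤ η) : ∃ ρ, ρ ≤ x ∧ Minimal (fun z => ¬ z ≤ η) ρ :=
  exists_maximal_not_ge (L := Lᵒᵈ) (ρ := OrderDual.toDual η)
    (σ := OrderDual.toDual θ) hθ h (y := OrderDual.toDual x) hx

theorem mplus_le_of_lt {L : Type*} [CompleteLattice L] {η z : L} (h : η < z) : mplus η ≤ z :=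
  sInf_le h

/-- A minimal element not below `η` spans an interval transposing up to `[η, η⁺]`. -/
theorem transUp_of_minimal_not_le {L : Type*} [CompleteLattice L] [IsModularLattice L]
    {η ρ : L} (hη : MeetIrred η) (hρ : Minimal (fun z => ¬ z ≤ η) ρ) :
    TransUp (ρ ⊓ η, ρ) (η, mplus η) := by
  have hlt : η < ρ ⊔ η := right_lt_sup.2 hρ.1
  have hle : mplus η ≤ ρ ⊔ η := mplus_le_of_lt hlt
  have hρle : ρ ≤ mplus η := by
    by_contra hcon
    have h1 : ρ ⊓ mplus η ≤ η := by
      by_contra h2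
      exact hcon ((hρ.2 h2 inf_le_left).trans inf_le_right)
    have h3 : (η ⊔ ρ) ⊓ mplus η ≤ η := by
      rw [sup_inf_assoc_of_le ρ hη.le]
      exact sup_le le_rfl h1
    rw [sup_comm, inf_eq_right.2 hle] at h3
    exact hη.not_ge h3
  exact ⟨le_antisymm hle (sup_le hρle hη.le), rfl⟩

/-- A maximal element `φ` not above a join irreducible `ρ` is meet irreducible, and `[ρ⁻, ρ]`
transposes up to `[φ, φ⁺]`. -/
theorem transUp_of_maximal_not_ge {L : Type*} [CompleteLattice L] [IsModularLattice L]
    {ρ σ φ : L} (hσ : σ < ρ) (h : ∀ z, z < ρ → z ≤ σ)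
    (hφ : Maximal (fun z => ¬ ρ ≤ z) φ) :
    MeetIrred φ ∧ TransUp (σ, ρ) (φ, mplus φ) := by
  have hge : ∀ z, φ < z → ρ ≤ z := fun z hz => by
    by_contra hcon
    exact hz.not_ge (hφ.2 hcon hz.le)
  have hlt : φ < ρ ⊔ φ := right_lt_sup.2 hφ.1
  have hplus : mplus φ = ρ ⊔ φ :=
    le_antisymm (mplus_le_of_lt hlt) (le_sInf fun z hz => sup_le (hge z hz) hz.le)
  have hinf : ρ ⊓ φ ≤ σ := h _ (inf_lt_left.2 hφ.1)
  have hσφ : σ ≤ φ := by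
    by_contra hcon
    have h1 : ρ ≤ σ ⊔ φ := hge _ (right_lt_sup.2 hcon)
    have h2 : (σ ⊔ φ) ⊓ ρ ≤ σ := by
      rw [sup_inf_assoc_of_le φ hσ.le, inf_comm]
      exact sup_le le_rfl hinf
    rw [inf_eq_right.2 h1] at h2
    exact hσ.not_ge h2
  exact ⟨hlt.trans_eq hplus.symm, hplus, le_antisymm (le_inf hσ.le hσφ) hinf⟩

/-- A lonesome meet irreducible element of a bialgebraic modular lattice is meet prime. -/
theorem LonesomeMeet.infPrime {L : Type*} [CompleteLattice L] [IsModularLattice L]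
    [IsCompactlyGenerated L] [IsCompactlyGenerated Lᵒᵈ] {η : L} (hη : LonesomeMeet η) :
    InfPrime η := by
  obtain ⟨hirr, huniq⟩ := hη
  refine ⟨not_isMax_of_lt hirr, fun x y hxy => ?_⟩
  by_contra! hcon
  obtain ⟨hx, hy⟩ := hcon
  obtain ⟨ρ, hρx, hρ⟩ := exists_minimal_not_le hirr (fun z => mplus_le_of_lt) hx
  have hσ : ρ ⊓ η < ρ := inf_lt_left.2 hρ.1
  have hlow : ∀ z, z < ρ → z ≤ ρ ⊓ η := fun z hz => le_inf hz.le <| by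
    by_contra hz'
    exact hz.not_ge (hρ.2 hz' hz.le)
  have hρy : ¬ ρ ≤ y := fun h => hρ.1 ((le_inf hρx h).trans hxy)
  obtain ⟨φ, hyφ, hφ⟩ := exists_maximal_not_ge hσ hlow hρy
  obtain ⟨hφirr, hφt⟩ := transUp_of_maximal_not_ge hσ hlow hφ
  have hφη := huniq φ hφirr
    ((Relation.EqvGen.symm _ _ (.rel _ _ hφt)).trans _ _ _
      (.rel _ _ (transUp_of_minimal_not_le hirr hρ)))
  exact hy (hφη ▸ hyφ)

/-- A lonesome meet irreducible element of a bialgebraic modular lattice is completely meet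
prime. -/
theorem LonesomeMeet.exists_le_of_sInf_le {L : Type*} [CompleteLattice L] [IsModularLattice L]
    [IsCompactlyGenerated L] [IsCompactlyGenerated Lᵒᵈ] {η : L} (hη : LonesomeMeet η)
    (X : Set L) (hX : sInf X ≤ η) : ∃ x ∈ X, x ≤ η := by
  classical
  have hdir : DirectedOn (· ≥ ·) {d : L | ∃ t : Finset L, ↑t ⊆ X ∧ t.inf id = d} := by
    rintro _ ⟨s, hs, rfl⟩ _ ⟨t, ht, rfl⟩
    refine ⟨(s ∪ t).inf id, ⟨s ∪ t, ?_, rfl⟩, ?_, ?_⟩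
    · rw [Finset.coe_union]
      exact Set.union_subset hs ht
    · exact Finset.inf_mono Finset.subset_union_left
    · exact Finset.inf_mono Finset.subset_union_right
  obtain ⟨_, ⟨t, ht, rfl⟩, hle⟩ :=
    exists_le_of_sInf_le_of_directedOn hη.1 (fun z => mplus_le_of_lt) hdir
      (le_trans (le_sInf fun x hx => sInf_le ⟨{x}, by simpa using hx, by simp⟩) hX)
  obtain ⟨x, hx, hxη⟩ := hη.infPrime.finset_inf_le.1 hle
  exact ⟨x, ht hx, hxη⟩

/-- Truth-valued lattice homomorphisms separate the ends of an interval exactly when they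
separate the ends of any projective interval. -/
theorem ProjIntv.iff_congr {L : Type*} [Lattice L] {h : L → Prop}
    (hsup : ∀ a b, h (a ⊔ b) ↔ h a ∨ h b) (hinf : ∀ a b, h (a ⊓ b) ↔ h a ∧ h b)
    {p q : L × L} (hpq : ProjIntv p q) : (h p.1 ↔ h p.2) ↔ (h q.1 ↔ h q.2) := by
  induction hpq with
  | rel p q hr => rw [hr.1, hr.2, hsup, hinf]; tauto
  | refl => rfl
  | symm _ _ _ ih => exact ih.symm
  | trans _ _ _ _ _ ih₁ ih₂ => exact ih₁.trans ih₂

/-- For a completely meet prime `η`, failing to lie below `η` is a complete lattice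
homomorphism. -/
theorem isCompleteLatticeHom_not_le {L : Type*} [CompleteLattice L] {η : L}
    (hη : ∀ X : Set L, sInf X ≤ η → ∃ x ∈ X, x ≤ η) :
    IsCompleteLatticeHom (fun x : L => ¬ x ≤ η) := by
  refine ⟨fun S => propext ?_, fun S => propext ?_⟩
  · simp only [sSup_Prop_eq, Set.exists_mem_image, sSup_le_iff, not_forall, exists_prop]
  · simp only [sInf_Prop_eq, Set.forall_mem_image]
    exact ⟨fun h x hx hxη => h ((sInf_le hx).trans hxη),
      fun h hle => let ⟨x, hx, hxη⟩ := hη S hle; h hx hxη⟩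

theorem le_and_not_le_of_projIntv_mplus {L : Type*} [CompleteLattice L] {a b η : L}
    (hη : ∀ X : Set L, sInf X ≤ η → ∃ x ∈ X, x ≤ η) (hirr : MeetIrred η) (hab : a ≤ b)
    (hproj : ProjIntv (a, b) (η, mplus η)) : a ≤ η ∧ ¬ b ≤ η := by
  have key := hproj.iff_congr (h := fun x => ¬ x ≤ η)
    (fun a b => by rw [sup_le_iff]; tauto) (fun a b => by
      refine ⟨fun h => ⟨fun ha => h (inf_le_left.trans ha), fun hb => h (inf_le_right.trans hb)⟩,
        fun ⟨ha, hb⟩ hle => ?_⟩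
      obtain ⟨x, hx, hxη⟩ := hη {a, b} (by rwa [sInf_pair])
      rcases hx with rfl | rfl
      exacts [ha hxη, hb hxη])
  have h1 : ¬ mplus η ≤ η := hirr.not_ge
  have h2 : b ≤ η → a ≤ η := hab.trans
  have h3 : η ≤ η := le_rfl
  dsimp only at key
  tauto

/-- characterization of lonesome meet irreducible elements in a
bialgebraic modular lattice (the two-element lattice is modelled by `Prop`). -/
theorem statement11 {L : Type*} [CompleteLattice L] [IsModularLattice L]
    [IsCompactlyGenerated L] [IsCompactlyGenerated Lᵒᵈ]
    (α β η : L) (hab : α ⋖ β) (hη : MeetIrred η)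
    (hproj : ProjIntv (α, β) (η, mplus η)) :
    (LonesomeMeet η ↔ ∀ X : Set L, sInf X ≤ η → ∃ x ∈ X, x ≤ η) ∧
    (LonesomeMeet η ↔ ∃ h : L → Prop,
      IsCompleteLatticeHom h ∧ Function.Surjective h ∧
      ¬ h α ∧ ¬ h η ∧ h β ∧ h (mplus η)) := by
  have h12 : LonesomeMeet η → ∀ X : Set L, sInf X ≤ η → ∃ x ∈ X, x ≤ η :=
    LonesomeMeet.exists_le_of_sInf_le
  have h21 : (∀ X : Set L, sInf X ≤ η → ∃ x ∈ X, x ≤ η) → LonesomeMeet η := by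
    refine fun hprime => ⟨hη, fun φ hφ hp => ?_⟩
    obtain ⟨hφη, hφη'⟩ := le_and_not_le_of_projIntv_mplus hprime hη hφ.le hp
    by_contra hne
    exact hφη' (mplus_le_of_lt (lt_of_le_of_ne hφη hne))
  refine ⟨⟨h12, h21⟩, fun hl => ?_, ?_⟩
  · have hprime := h12 hl
    obtain ⟨hα, hβ⟩ := le_and_not_le_of_projIntv_mplus hprime hη hab.le hproj
    refine ⟨fun x => ¬ x ≤ η, isCompleteLatticeHom_not_le hprime, fun p => ?_,
      not_not.2 hα, not_not.2 le_rfl, hβ, hη.not_ge⟩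
    by_cases hp : p
    · exact ⟨mplus η, propext (iff_of_true hη.not_ge hp)⟩
    · exact ⟨η, propext (iff_of_false (not_not.2 le_rfl) hp)⟩
  · rintro ⟨h, ⟨hsup, hinf⟩, -, -, hη0, -, hη1⟩
    have hmono : ∀ {a b : L}, a ≤ b → h a → h b := fun {a b} hab' ha => by
      have := hsup {a, b}
      rw [sSup_pair, sup_eq_right.2 hab', sSup_Prop_eq] at this
      rw [this]
      exact ⟨h a, ⟨a, by simp, rfl⟩, ha⟩
    refine h21 fun X hX => ?_
    by_contra! hcon
    refine hη0 (hmono hX ?_)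
    rw [hinf X, sInf_Prop_eq]
    rintro _ ⟨x, hx, rfl⟩
    have hs := hmono (mplus_le_of_lt (right_lt_sup.2 (hcon x hx))) hη1
    rw [← sSup_pair, hsup, sSup_Prop_eq] at hs
    obtain ⟨_, ⟨z, hz, rfl⟩, hzt⟩ := hs
    rcases hz with rfl | rfl
    exacts [hzt, absurd hzt hη0]
end

section
/- Let K be a complete lattice and let L be a complete sublattice of K. Then for all x, y ∈ L, ⌊x,y⌋_L ≥ ⌊x,y⌋_K, where ⌊·,·⌋_L and ⌊·,·⌋_K denote the largest commutator operations on L and K respectively. -/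
namespace IsCompleteSublatticeEmb

variable {L K : Type*} [CompleteLattice L] [CompleteLattice K] {e : L → K}

theorem monotone (he : IsCompleteSublatticeEmb e) : Monotone e := by
  intro a b hab
  have h := he.2.1 {a, b} ⟨a, Set.mem_insert _ _⟩
  rw [sSup_pair, sup_eq_right.2 hab, Set.image_pair, sSup_pair] at h
  exact le_sup_left.trans h.ge

/-- The restriction of a binary operation on `K` to `L`, rounded up to the least element of `L`
above it. -/
def restrict (e : L → K) (c : K → K → K) (a b : L) : L :=
  sInf {z : L | c (e a) (e b) ≤ e z}

theorem restrict_le_iff (he : IsCompleteSublatticeEmb e) {c : K → K → K}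
    (hc : IsCommutatorMult c) {a b z : L} :
    restrict e c a b ≤ z ↔ c (e a) (e b) ≤ e z := by
  refine ⟨fun h => le_trans ?_ (he.monotone h), fun h => sInf_le h⟩
  rw [restrict, he.2.2 _ ⟨a, (hc.2.1 _ _).trans inf_le_left⟩]
  refine le_sInf ?_
  rintro _ ⟨w, hw, rfl⟩
  exact hw

theorem isCommutatorMult_restrict (he : IsCompleteSublatticeEmb e) {c : K → K → K}
    (hc : IsCommutatorMult c) : IsCommutatorMult (restrict e c) := by
  have hle (a b : L) : restrict e c a b ≤ a ⊓ b :=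
    le_inf ((he.restrict_le_iff hc).2 ((hc.2.1 _ _).trans inf_le_left))
      ((he.restrict_le_iff hc).2 ((hc.2.1 _ _).trans inf_le_right))
  refine ⟨fun a b => by simp only [restrict, hc.1 (e a) (e b)], hle, fun S b => ?_⟩
  rcases S.eq_empty_or_nonempty with rfl | hS
  · simpa using (hle ⊥ b).trans inf_le_left
  · refine eq_of_forall_ge_iff fun z => ?_
    rw [he.restrict_le_iff hc, he.2.1 S hS, hc.2.2]
    simp [he.restrict_le_iff hc]

end IsCompleteSublatticeEmb

/-- the largest commutator operation of a complete sublattice dominates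
the one of the ambient lattice. -/
theorem statement12 {L K : Type*} [CompleteLattice L] [CompleteLattice K]
    (e : L → K) (he : IsCompleteSublatticeEmb e) (x y : L) :
    lcomm (e x) (e y) ≤ e (lcomm x y) := by
  refine sSup_le ?_
  rintro _ ⟨c, hc, rfl⟩
  exact (he.restrict_le_iff hc).1 (le_sSup ⟨_, he.isCommutatorMult_restrict hc, rfl⟩)
end

section
/- Let L and K be complete lattices and let h : L → K be a complete lattice homomorphism. Then for all x, y ∈ L, h(⌊x,y⌋_L) ≥ ⌊h(x), h(y)⌋_K, where ⌊·,·⌋_L and ⌊·,·⌋_K denote the largest commutator operations on L and K respectively. -/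
/-- The lower adjoint of a map `h` between complete lattices that preserves meets. -/
def lowerAdjoint {L K : Type*} [CompleteLattice L] [LE K] (h : L → K) (k : K) : L :=
  sInf {z : L | k ≤ h z}

theorem IsCompleteLatticeHom.galoisConnection {L K : Type*} [CompleteLattice L]
    [CompleteLattice K] {h : L → K} (hh : IsCompleteLatticeHom h) :
    GaloisConnection (lowerAdjoint h) h := by
  have hmono : Monotone h := fun a b hab => by
    have hsup := hh.1 {a, b}
    rw [Set.image_pair, sSup_pair, sSup_pair, sup_eq_right.2 hab] at hsup
    exact hsup ▸ le_sup_left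
  intro k z
  refine ⟨fun hkz => le_trans ?_ (hmono hkz), fun hkz => sInf_le hkz⟩
  rw [lowerAdjoint, hh.2]
  refine le_sInf ?_
  rintro _ ⟨w, hw, rfl⟩
  exact hw

/-- A commutator multiplication pulls back along a complete lattice homomorphism. -/
theorem IsCommutatorMult.comap {L K : Type*} [CompleteLattice L] [CompleteLattice K]
    {c : K → K → K} (hc : IsCommutatorMult c) {h : L → K} (hh : IsCompleteLatticeHom h) :
    IsCommutatorMult fun x y => lowerAdjoint h (c (h x) (h y)) := by
  have gc := hh.galoisConnection
  refine ⟨fun x y => congrArg _ (hc.1 _ _), fun x y => ?_, fun S y => ?_⟩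
  · exact le_inf (gc.l_le ((hc.2.1 _ _).trans inf_le_left))
      (gc.l_le ((hc.2.1 _ _).trans inf_le_right))
  · simp only [hh.1, hc.2.2, iSup_image, gc.l_iSup]

/-- the largest commutator operation and complete lattice homomorphisms. -/
theorem statement13 {L K : Type*} [CompleteLattice L] [CompleteLattice K]
    (h : L → K) (hh : IsCompleteLatticeHom h) (x y : L) :
    lcomm (h x) (h y) ≤ h (lcomm x y) := by
  refine sSup_le ?_
  rintro _ ⟨c, hc, rfl⟩
  have gc := hh.galoisConnection
  exact (gc.le_u_l _).trans (gc.monotone_u (le_sSup ⟨_, hc.comap hh, rfl⟩))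
end

section
/- Let L be a complete lattice, and let K be either a complete (0,1)-extension of L (i.e., L is a complete sublattice of K containing 0_K and 1_K) or a complete (0,1)-homomorphic image of L (i.e., there is a surjective complete lattice homomorphism L → K). If L forces abelian type, then so does K; if L forces nilpotent type, then so does K; if L forces solvable type, then so does K. -/
theorem IsCommutatorMult.mono {L : Type*} [CompleteLattice L] {c : L → L → L}
    (hc : IsCommutatorMult c) {x x' y y' : L} (hx : x ≤ x') (hy : y ≤ y') :
    c x y ≤ c x' y' := by
  have mono_left : ∀ {a b : L} (d : L), a ≤ b → c a d ≤ c b d := by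
    intro a b d hab
    have h := hc.2.2 {a, b} d
    rw [sSup_pair, sup_eq_right.2 hab, iSup_pair] at h
    exact h ▸ le_sup_left
  calc c x y ≤ c x' y := mono_left y hx
    _ = c y x' := hc.1 _ _
    _ ≤ c y' x' := mono_left x' hy
    _ = c x' y' := hc.1 _ _

theorem IsCommutatorMult.le_lcomm {L : Type*} [CompleteLattice L] {c : L → L → L}
    (hc : IsCommutatorMult c) (x y : L) : c x y ≤ lcomm x y :=
  le_sSup ⟨c, hc, rfl⟩

theorem lcomm_mono {L : Type*} [CompleteLattice L] {x x' y y' : L} (hx : x ≤ x') (hy : y ≤ y') :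
    lcomm x y ≤ lcomm x' y' := by
  refine sSup_le ?_
  rintro _ ⟨c, hc, rfl⟩
  exact (hc.mono hx hy).trans (hc.le_lcomm x' y')

namespace IsCompleteLatticeHom

variable {L K : Type*} [CompleteLattice L] [CompleteLattice K] {f : L → K}

theorem map_top (hf : IsCompleteLatticeHom f) : f ⊤ = ⊤ := by
  simpa using hf.2 ∅

theorem map_bot (hf : IsCompleteLatticeHom f) : f ⊥ = ⊥ := by
  simpa using hf.1 ∅

theorem map_inf (hf : IsCompleteLatticeHom f) (x y : L) : f (x ⊓ y) = f x ⊓ f y := by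
  simpa [Set.image_pair] using hf.2 {x, y}

theorem monotone_s14 (hf : IsCompleteLatticeHom f) : Monotone f := fun x y hxy =>
  inf_eq_left.1 (by rw [← hf.map_inf, inf_eq_left.2 hxy])

/-- A complete lattice homomorphism has a lower adjoint. -/
theorem gc (hf : IsCompleteLatticeHom f) :
    GaloisConnection (fun k => sInf {l | k ≤ f l}) f := by
  intro k l
  refine ⟨fun h => le_trans ?_ (hf.monotone_s14 h), fun h => sInf_le h⟩
  rw [hf.2]
  exact le_sInf (by rintro _ ⟨m, hm, rfl⟩; exact hm)

/-- The pullback of a commutator multiplication along a complete lattice homomorphism,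
formed with the lower adjoint, is a commutator multiplication. -/
theorem isCommutatorMult_pullback (hf : IsCompleteLatticeHom f) {g : K → L}
    (hgf : GaloisConnection g f) {c : K → K → K} (hc : IsCommutatorMult c) :
    IsCommutatorMult fun x y => g (c (f x) (f y)) := by
  refine ⟨fun x y => congrArg g (hc.1 _ _), fun x y => ?_, fun S y => ?_⟩
  · rw [hgf.le_iff_le, hf.map_inf]
    exact hc.2.1 _ _
  · simp only [hf.1, hc.2.2, iSup_image, hgf.l_iSup]

theorem lcomm_le (hf : IsCompleteLatticeHom f) (x y : L) :
    lcomm (f x) (f y) ≤ f (lcomm x y) := by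
  refine sSup_le ?_
  rintro _ ⟨c, hc, rfl⟩
  exact hf.gc.le_iff_le.1 ((hf.isCommutatorMult_pullback hf.gc hc).le_lcomm x y)

theorem derivedSeq_le (hf : IsCompleteLatticeHom f) (n : ℕ) :
    derivedSeq lcomm n ≤ f (derivedSeq lcomm n) := by
  induction n with
  | zero => exact hf.map_top.ge
  | succ n ih => exact (lcomm_mono ih ih).trans (hf.lcomm_le _ _)

theorem lowerCentralSeq_le (hf : IsCompleteLatticeHom f) (n : ℕ) :
    lowerCentralSeq lcomm n ≤ f (lowerCentralSeq lcomm n) := by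
  induction n with
  | zero => exact hf.map_top.ge
  | succ n ih => exact (lcomm_mono hf.map_top.ge ih).trans (hf.lcomm_le _ _)

end IsCompleteLatticeHom

theorem IsCompleteSublatticeEmb.isCompleteLatticeHom {L K : Type*} [CompleteLattice L]
    [CompleteLattice K] {e : L → K} (he : IsCompleteSublatticeEmb e) (hbot : e ⊥ = ⊥)
    (htop : e ⊤ = ⊤) : IsCompleteLatticeHom e := by
  refine ⟨fun S => ?_, fun S => ?_⟩ <;> rcases S.eq_empty_or_nonempty with rfl | hS
  · simpa using hbot
  · exact he.2.1 S hS
  · simpa using htop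
  · exact he.2.2 S hS

/-- forcing abelian, nilpotent, or solvable type is inherited by
complete (0,1)-extensions and complete (0,1)-homomorphic images. -/
theorem statement14 {L K : Type*} [CompleteLattice L] [CompleteLattice K]
    (hLK : (∃ e : L → K, IsCompleteSublatticeEmb e ∧ e ⊥ = ⊥ ∧ e ⊤ = ⊤) ∨
           (∃ h : L → K, IsCompleteLatticeHom h ∧ Function.Surjective h)) :
    (ForcesAbelianType L → ForcesAbelianType K) ∧
    (ForcesNilpotentType L → ForcesNilpotentType K) ∧
    (ForcesSolvableType L → ForcesSolvableType K) := by
  obtain ⟨f, hf⟩ : ∃ f : L → K, IsCompleteLatticeHom f := by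
    rcases hLK with ⟨e, he, hbot, htop⟩ | ⟨h, hh, -⟩
    · exact ⟨e, he.isCompleteLatticeHom hbot htop⟩
    · exact ⟨h, hh⟩
  refine ⟨fun hL => ?_, ?_, ?_⟩
  · have h := hf.lcomm_le ⊤ ⊤
    rw [hf.map_top, show lcomm (⊤ : L) ⊤ = ⊥ from hL, hf.map_bot] at h
    exact le_bot_iff.1 h
  · rintro ⟨n, hn⟩
    have h := hf.lowerCentralSeq_le n
    rw [hn, hf.map_bot] at h
    exact ⟨n, le_bot_iff.1 h⟩
  · rintro ⟨n, hn⟩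
    have h := hf.derivedSeq_le n
    rw [hn, hf.map_bot] at h
    exact ⟨n, le_bot_iff.1 h⟩
end

section
/- Let K be a complete lattice. If K has a complete (0,1)-sublattice L with at least 3 elements that is algebraic, modular, simple, and complemented, then K forces abelian type, i.e., every commutator multiplication c on K satisfies c(1,1) = 0. -/
theorem IsCompleteSublatticeEmb.map_sup {L K : Type*} [CompleteLattice L] [CompleteLattice K]
    {e : L → K} (he : IsCompleteSublatticeEmb e) (x y : L) : e (x ⊔ y) = e x ⊔ e y := by
  simpa [Set.image_pair] using he.2.1 {x, y} (Set.insert_nonempty _ _)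

theorem IsCompleteSublatticeEmb.map_inf {L K : Type*} [CompleteLattice L] [CompleteLattice K]
    {e : L → K} (he : IsCompleteSublatticeEmb e) (x y : L) : e (x ⊓ y) = e x ⊓ e y := by
  simpa [Set.image_pair] using he.2.2 {x, y} (Set.insert_nonempty _ _)

theorem IsCommutatorMult.sup_left {K : Type*} [CompleteLattice K] {c : K → K → K}
    (hc : IsCommutatorMult c) (x y z : K) : c (x ⊔ y) z = c x z ⊔ c y z := by
  rw [← sSup_pair, hc.2.2, iSup_pair]

theorem IsCommutatorMult.mono_left {K : Type*} [CompleteLattice K] {c : K → K → K}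
    (hc : IsCommutatorMult c) {x y : K} (hxy : x ≤ y) (z : K) : c x z ≤ c y z := by
  rw [← sup_eq_right.2 hxy, hc.sup_left]
  exact le_sup_left

theorem IsCommutatorMult.sSup_sSup_eq_bot {K : Type*} [CompleteLattice K] {c : K → K → K}
    (hc : IsCommutatorMult c) {S : Set K} (h : ∀ x ∈ S, ∀ y ∈ S, c x y = ⊥) :
    c (sSup S) (sSup S) = ⊥ := by
  rw [hc.2.2]
  simp only [iSup_eq_bot]
  intro x hx
  rw [hc.1, hc.2.2]
  simp only [iSup_eq_bot]
  exact fun y hy => h y hy x hx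

/-- For a join prime element `p`, lying above `p` or not is a lattice congruence with at most two
classes. -/
theorem isLatticeCongruence_le_iff_le {L : Type*} [Lattice L] {p : L}
    (hp : ∀ x y : L, p ≤ x ⊔ y → p ≤ x ∨ p ≤ y) :
    IsLatticeCongruence fun x y : L => (p ≤ x ↔ p ≤ y) := by
  have hsup : ∀ x y : L, p ≤ x ⊔ y ↔ p ≤ x ∨ p ≤ y := fun x y =>
    ⟨hp x y, fun h => h.elim (fun h => h.trans le_sup_left) (fun h => h.trans le_sup_right)⟩
  refine ⟨⟨fun _ => Iff.rfl, fun h => h.symm, fun h k => h.trans k⟩, fun a b x y hab hxy => ?_⟩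
  simp only [hsup, le_inf_iff, hab, hxy, and_self]

/-- A simple lattice with at least three elements has no nonzero join prime element. -/
theorem SimpleLattice.exists_le_sup {L : Type*} [Lattice L] [OrderBot L]
    (hsimple : SimpleLattice L) (hcard : ∃ a b c : L, a ≠ b ∧ a ≠ c ∧ b ≠ c) {p : L}
    (hp : p ≠ ⊥) : ∃ x y : L, p ≤ x ⊔ y ∧ ¬ p ≤ x ∧ ¬ p ≤ y := by
  by_contra! h
  have hprime : ∀ x y : L, p ≤ x ⊔ y → p ≤ x ∨ p ≤ y := fun x y hxy =>
    or_iff_not_imp_left.2 (h x y hxy)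
  rcases hsimple _ (isLatticeCongruence_le_iff_le hprime) with heq | hall
  · obtain ⟨a, b, c, hab, hac, hbc⟩ := hcard
    rw [Ne, ← heq] at hab hac hbc
    tauto
  · exact hp (le_bot_iff.1 ((hall p ⊥).1 le_rfl))

/-- a complete lattice with an algebraic, modular, simple, complemented
complete (0,1)-sublattice of at least 3 elements forces abelian type. -/
theorem statement15 {K L : Type*} [CompleteLattice K] [CompleteLattice L]
    (e : L → K) (he : IsCompleteSublatticeEmb e) (h0 : e ⊥ = ⊥) (h1 : e ⊤ = ⊤)
    (hcard : ∃ a b c : L, a ≠ b ∧ a ≠ c ∧ b ≠ c)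
    (halg : IsCompactlyGenerated L) (hmod : IsModularLattice L)
    (hsimple : SimpleLattice L) (hcompl : ComplementedLattice L) :
    ∀ c : K → K → K, IsCommutatorMult c → c ⊤ ⊤ = ⊥ := by
  intro c hc
  have hdisj : ∀ x y : L, x ⊓ y = ⊥ → c (e x) (e y) = ⊥ := fun x y hxy =>
    le_bot_iff.1 ((hc.2.1 _ _).trans_eq (by rw [← he.map_inf, hxy, h0]))
  have hatom : ∀ p q : L, IsAtom p → IsAtom q → c (e p) (e q) = ⊥ := by
    intro p q hp hq
    by_cases hpq : p = q
    · subst hpq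
      obtain ⟨x, y, hxy, hx, hy⟩ := hsimple.exists_le_sup hcard hp.1
      have hle : e p ≤ e x ⊔ e y := by
        rw [← he.map_sup, ← inf_eq_left, ← he.map_inf, inf_eq_left.2 hxy]
      refine le_bot_iff.1 ((hc.mono_left hle _).trans_eq ?_)
      rw [hc.sup_left, hdisj x p (hp.not_le_iff_disjoint.1 hx).symm.eq_bot,
        hdisj y p (hp.not_le_iff_disjoint.1 hy).symm.eq_bot, sup_bot_eq]
    · exact hdisj p q (hp.disjoint_of_ne hq hpq).eq_bot
  have hne : {p : L | IsAtom p}.Nonempty := by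
    by_contra hemp
    have htop : (⊤ : L) = ⊥ := by
      rw [← sSup_atoms_eq_top, Set.not_nonempty_iff_eq_empty.1 hemp, sSup_empty]
    have := subsingleton_of_bot_eq_top htop.symm
    obtain ⟨a, b, _, hab, _⟩ := hcard
    exact hab (Subsingleton.elim a b)
  rw [← h1, ← sSup_atoms_eq_top, he.2.1 _ hne]
  apply hc.sSup_sSup_eq_bot
  rintro _ ⟨p, hp, rfl⟩ _ ⟨q, hq, rfl⟩
  exact hatom p q hp hq
end
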